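/- For every n > 0 and every β ∈ ℝ, one has exp(−(n/2)(β + √(β² + 4))) = ∫₀^∞ exp(−(n/2)β) · (2π)^{−1/2} v^{−3/2} exp(−1/(2v)) · exp(−(v/2)(n/2)² (β² + 4)) dv. -/

import Mathlib

open MeasureTheory Real

theorem hasDerivAt_const_div (c : ℝ) {x : ℝ} (hx : x ≠ 0) :
    HasDerivAt (fun x : ℝ => c / x) (-(c / x ^ 2)) x :=
  ((hasDerivAt_const x c).div (hasDerivAt_id x) hx).congr_deriv (by simp [neg_div])

theorem hasDerivAt_sub_const_div (c : ℝ) {x : ℝ} (hx : x ≠ 0) :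
    HasDerivAt (fun x : ℝ => x - c / x) (1 + c / x ^ 2) x :=
  ((hasDerivAt_id x).sub (hasDerivAt_const_div c hx)).congr_deriv (sub_neg_eq_add _ _)

theorem image_sub_const_div_Ioi {c : ℝ} (hc : 0 < c) :
    (fun x : ℝ => x - c / x) '' Set.Ioi 0 = Set.univ := by
  refine Set.eq_univ_of_forall fun s => ?_
  have hr : √(s ^ 2 + 4 * c) ^ 2 = s ^ 2 + 4 * c := Real.sq_sqrt (by positivity)
  have hs : |s| < √(s ^ 2 + 4 * c) := by
    rw [← Real.sqrt_sq_eq_abs]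
    exact Real.sqrt_lt_sqrt (sq_nonneg s) (by linarith)
  have hpos : 0 < (s + √(s ^ 2 + 4 * c)) / 2 := by linarith [neg_abs_le s]
  refine ⟨(s + √(s ^ 2 + 4 * c)) / 2, hpos, ?_⟩
  have hne := hpos.ne'
  rw [sub_eq_iff_eq_add, ← sub_eq_iff_eq_add', eq_div_iff hne]
  linear_combination hr / 4

theorem monotoneOn_sub_const_div_Ioi {c : ℝ} (hc : 0 < c) :
    MonotoneOn (fun x : ℝ => x - c / x) (Set.Ioi 0) := by
  intro x hx y _ hxy
  have : c / y ≤ c / x := div_le_div_of_nonneg_left hc.le hx hxy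
  simp only
  linarith

theorem integral_const_div_sq_mul_comp_const_div_Ioi {c : ℝ} (hc : 0 < c) (g : ℝ → ℝ) :
    ∫ x in Set.Ioi (0 : ℝ), c / x ^ 2 * g (c / x) = ∫ x in Set.Ioi (0 : ℝ), g x := by
  have himage : (fun x : ℝ => c / x) '' Set.Ioi 0 = Set.Ioi 0 := by
    ext y
    constructor
    · rintro ⟨x, hx, rfl⟩
      exact div_pos hc hx
    · intro hy
      exact ⟨c / y, div_pos hc hy, div_div_cancel₀ hc.ne'⟩
  have h := integral_image_eq_integral_deriv_smul_of_antitoneOn (s := Set.Ioi (0 : ℝ))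
    (f := fun x => c / x) (f' := fun x => -(c / x ^ 2)) measurableSet_Ioi
    (fun x hx => (hasDerivAt_const_div c (ne_of_gt hx)).hasDerivWithinAt)
    (fun x hx y _ hxy => div_le_div_of_nonneg_left hc.le hx hxy) g
  rw [himage] at h
  simpa using h.symm

/-- The Cauchy–Schlömilch substitution for an even integrable function. -/
theorem two_mul_integral_comp_sub_const_div_Ioi {c : ℝ} (hc : 0 < c) {f : ℝ → ℝ}
    (hf : Integrable f) (heven : ∀ x, f (-x) = f x) :
    2 * ∫ x in Set.Ioi (0 : ℝ), f (x - c / x) = ∫ x, f x := by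
  have hderiv : ∀ x ∈ Set.Ioi (0 : ℝ),
      HasDerivWithinAt (fun x : ℝ => x - c / x) (1 + c / x ^ 2) (Set.Ioi 0) x :=
    fun x hx => (hasDerivAt_sub_const_div c (ne_of_gt hx)).hasDerivWithinAt
  have hmono := monotoneOn_sub_const_div_Ioi hc
  have hint := integral_image_eq_integral_deriv_smul_of_monotoneOn measurableSet_Ioi hderiv hmono f
  have hweighted := integrableOn_image_iff_integrableOn_deriv_smul_of_monotoneOn
    measurableSet_Ioi hderiv hmono f
  rw [image_sub_const_div_Ioi hc] at hint hweighted
  have hweighted := hweighted.1 hf.integrableOn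
  have hcomp : IntegrableOn (fun x => f (x - c / x)) (Set.Ioi 0) := by
    have h : IntegrableOn (fun x => (1 + c / x ^ 2)⁻¹ * ((1 + c / x ^ 2) • f (x - c / x)))
        (Set.Ioi 0) := by
      refine hweighted.bdd_mul (c := 1)
        (Measurable.aestronglyMeasurable (by fun_prop)) (.of_forall fun x => ?_)
      have : 0 ≤ c / x ^ 2 := by positivity
      rw [Real.norm_eq_abs, abs_of_nonneg (by positivity)]
      exact inv_le_one_of_one_le₀ (by linarith)
    refine h.congr_fun (fun x _ => ?_) measurableSet_Ioi
    have : 1 + c / x ^ 2 ≠ 0 := by positivity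
    simp only [smul_eq_mul]
    field_simp
  have hrest : IntegrableOn (fun x => c / x ^ 2 * f (x - c / x)) (Set.Ioi 0) := by
    refine (hweighted.sub hcomp).congr_fun (fun x _ => ?_) measurableSet_Ioi
    simp only [Pi.sub_apply, smul_eq_mul]
    ring
  have hsymm : ∫ x in Set.Ioi (0 : ℝ), c / x ^ 2 * f (x - c / x) =
      ∫ x in Set.Ioi (0 : ℝ), f (x - c / x) := by
    rw [← integral_const_div_sq_mul_comp_const_div_Ioi hc fun x => f (x - c / x)]
    refine setIntegral_congr_fun measurableSet_Ioi fun x _ => ?_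
    rw [div_div_cancel₀ hc.ne', ← neg_sub, heven]
  rw [setIntegral_univ] at hint
  rw [hint]
  simp only [smul_eq_mul, add_mul, one_mul]
  rw [integral_add hcomp hrest, hsymm, two_mul]

/-- The Laplace transform of the unnormalized inverse Gamma density with shape and rate `1 / 2`. -/
theorem integral_rpow_neg_three_halves_mul_exp {c : ℝ} (hc : 0 < c) :
    ∫ v in Set.Ioi (0 : ℝ), v ^ (-(3 : ℝ) / 2) * rexp (-1 / (2 * v)) * rexp (-(v / 2) * c ^ 2) =
      √(2 * π) * rexp (-c) := by
  have hgauss : ∫ x : ℝ, rexp (-(1 / 2) * x ^ 2) = √(2 * π) := by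
    rw [integral_gaussian]
    congr 1
    ring
  rw [← hgauss, ← two_mul_integral_comp_sub_const_div_Ioi hc
    (integrable_exp_neg_mul_sq (by norm_num)) (fun x => by rw [neg_sq]),
    ← integral_comp_rpow_Ioi _ (p := -2) (by norm_num), ← integral_const_mul,
    ← integral_mul_const]
  refine setIntegral_congr_fun measurableSet_Ioi fun x (hx : 0 < x) => ?_
  have hsq : x ^ (-2 : ℝ) = (x ^ 2)⁻¹ := by
    rw [Real.rpow_neg hx.le, Real.rpow_two]
  have hjac : x ^ ((-2 : ℝ) - 1) * (x ^ (-2 : ℝ)) ^ (-(3 : ℝ) / 2) = 1 := by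
    rw [← Real.rpow_mul hx.le, ← Real.rpow_add hx]
    norm_num
  have hexp : rexp (-1 / (2 * x ^ (-2 : ℝ))) * rexp (-(x ^ (-2 : ℝ) / 2) * c ^ 2) =
      rexp (-(1 / 2) * (x - c / x) ^ 2) * rexp (-c) := by
    rw [← Real.exp_add, ← Real.exp_add, hsq]
    congr 1
    field_simp
    ring
  have habs : |(-2 : ℝ)| = 2 := by norm_num
  simp only [smul_eq_mul, habs]
  rw [mul_assoc (2 : ℝ) (rexp _), ← hexp]
  linear_combination (2 * (rexp (-1 / (2 * x ^ (-2 : ℝ))) *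
    rexp (-(x ^ (-2 : ℝ) / 2) * c ^ 2))) * hjac

theorem invGauss_augmentation_zero_count (n : ℝ) (hn : 0 < n) (β : ℝ) :
    Real.exp (-(n / 2) * (β + Real.sqrt (β ^ 2 + 4))) =
      ∫ v in Set.Ioi (0 : ℝ),
        Real.exp (-(n / 2) * β) *
          ((2 * π) ^ (-(1 : ℝ) / 2) * v ^ (-(3 : ℝ) / 2) * Real.exp (-1 / (2 * v))) *
          Real.exp (-(v / 2) * (n / 2) ^ 2 * (β ^ 2 + 4)) := by
  have hc : 0 < n / 2 * √(β ^ 2 + 4) := by positivity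
  have hcsq : (n / 2 * √(β ^ 2 + 4)) ^ 2 = (n / 2) ^ 2 * (β ^ 2 + 4) := by
    rw [mul_pow, Real.sq_sqrt (by positivity)]
  have hnorm : (2 * π) ^ (-(1 : ℝ) / 2) * √(2 * π) = 1 := by
    rw [Real.sqrt_eq_rpow, ← Real.rpow_add (by positivity)]
    norm_num
  have h := integral_rpow_neg_three_halves_mul_exp hc
  rw [hcsq] at h
  calc rexp (-(n / 2) * (β + √(β ^ 2 + 4)))
      = rexp (-(n / 2) * β) * (2 * π) ^ (-(1 : ℝ) / 2) *
          (√(2 * π) * rexp (-(n / 2 * √(β ^ 2 + 4)))) := by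
        rw [mul_add, Real.exp_add, neg_mul (n / 2) √(β ^ 2 + 4)]
        linear_combination -(rexp (-(n / 2) * β) * rexp (-(n / 2 * √(β ^ 2 + 4)))) * hnorm
    _ = _ := by
        rw [← h, ← integral_const_mul]
        refine integral_congr_ae (.of_forall fun v => ?_)
        simp only [mul_assoc]
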